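/- Let a, b, b', c ∈ ℂ with c not a nonpositive integer, and let x, y ∈ ℂ with |x| < 1/4 and |y| < 1/4. Then the double series defining F₁(a,b,b',c;x,y) and F₁(a, c−b−b', b', c; −x/(1−x), (y−x)/(1−x)) converge absolutely, and F₁(a, b, b', c; x, y) = (1−x)^(−a) · F₁(a, c−b−b', b', c; −x/(1−x), (y−x)/(1−x)), where (1−x)^(−a) is the principal branch. -/

import Mathlib

noncomputable section

/-- The ascending Pochhammer symbol `(a)ₙ = a(a+1)⋯(a+n−1)` for a complex number `a`. -/
def poch (a : ℂ) (n : ℕ) : ℂ := (ascPochhammer ℂ n).eval a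

/-- General term of Appell's double series `F₂(a,b,b',c,c';x,y)`. -/
def F2term (a b b' c c' x y : ℂ) (ij : ℕ × ℕ) : ℂ :=
  poch a (ij.1 + ij.2) * poch b ij.1 * poch b' ij.2 /
    (poch c ij.1 * poch c' ij.2 * (Nat.factorial ij.1 : ℂ) * (Nat.factorial ij.2 : ℂ)) *
    x ^ ij.1 * y ^ ij.2

/-- General term of Appell's double series `F₁(a,b,b',c;x,y)`. -/
def F1term (a b b' c x y : ℂ) (ij : ℕ × ℕ) : ℂ :=
  poch a (ij.1 + ij.2) * poch b ij.1 * poch b' ij.2 /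
    (poch c (ij.1 + ij.2) * (Nat.factorial ij.1 : ℂ) * (Nat.factorial ij.2 : ℂ)) *
    x ^ ij.1 * y ^ ij.2

/-- General term of the Gauss hypergeometric series `F(a,b,c;x)`. -/
def Fterm (a b c x : ℂ) (i : ℕ) : ℂ :=
  poch a i * poch b i / (poch c i * (Nat.factorial i : ℂ)) * x ^ i

open Finset

/-- Normalised Pochhammer symbol. -/
def pochM (a : ℂ) (n : ℕ) : ℂ := poch a n / (Nat.factorial n : ℂ)

lemma poch_zero (a : ℂ) : poch a 0 = 1 := by simp [poch]

lemma poch_succ (a : ℂ) (n : ℕ) : poch a (n + 1) = poch a n * (a + n) := by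
  simp [poch, ascPochhammer_succ_eval]

lemma poch_add (a : ℂ) (m k : ℕ) : poch a (m + k) = poch a m * poch (a + m) k := by
  induction k with
  | zero => simp [poch_zero]
  | succ k ih => rw [← add_assoc, poch_succ, ih, poch_succ]; push_cast; ring

lemma poch_ne_zero {c : ℂ} (hc : ∀ n : ℕ, c ≠ -(n : ℂ)) (n : ℕ) : poch c n ≠ 0 := by
  induction n with
  | zero => simp [poch_zero]
  | succ k ih =>
    rw [poch_succ]
    refine mul_ne_zero ih fun h => hc k (eq_neg_of_add_eq_zero_left h)

lemma pochM_eq (a : ℂ) (n : ℕ) : pochM a n = Ring.multichoose a n := by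
  have h := Ring.factorial_nsmul_multichoose_eq_ascPochhammer a n
  rw [Polynomial.ascPochhammer_smeval_cast, Polynomial.ascPochhammer_smeval_eq_eval,
    nsmul_eq_mul] at h
  have h0 : (Nat.factorial n : ℂ) ≠ 0 := by exact_mod_cast Nat.factorial_ne_zero n
  rw [pochM, poch, div_eq_iff h0, ← h, mul_comm]

lemma poch_eq (a : ℂ) (n : ℕ) : poch a n = pochM a n * (Nat.factorial n : ℂ) := by
  have h0 : (Nat.factorial n : ℂ) ≠ 0 := by exact_mod_cast Nat.factorial_ne_zero n
  rw [pochM, div_mul_cancel₀ _ h0]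

lemma vander (C d : ℂ) (N : ℕ) :
    ∑ pk ∈ antidiagonal N, (-1) ^ pk.1 * pochM d pk.1 * pochM (C + pk.1) pk.2 =
      pochM (C - d) N := by
  rw [pochM_eq, Ring.multichoose_eq, show C - d + N - 1 = -d + (C + N - 1) by ring,
    Ring.add_choose_eq N (Commute.all _ _)]
  refine Finset.sum_congr rfl fun pk hpk => ?_
  have hN : (N : ℂ) = pk.1 + pk.2 := by exact_mod_cast (mem_antidiagonal.mp hpk).symm
  rw [pochM_eq, pochM_eq, Ring.multichoose_eq (C + _), Ring.choose_neg', Ring.multichoose_eq d,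
    hN]
  rw [Int.negOnePow_def, Units.smul_def, zsmul_eq_mul]
  simp [add_assoc]

lemma pochM_choose (b : ℂ) (j r : ℕ) :
    pochM b (r + j) * ((r + j).choose r : ℂ) = pochM b j * pochM (b + j) r := by
  have h0 (n : ℕ) : (Nat.factorial n : ℂ) ≠ 0 := by exact_mod_cast Nat.factorial_ne_zero n
  have h : ((r + j).choose r : ℂ) * r.factorial * j.factorial = (r + j).factorial := by
    rw [Nat.choose_symm_add]
    exact_mod_cast Nat.add_choose_mul_factorial_mul_factorial r j
  have h1 := h0 r
  have h2 := h0 j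
  have h3 := h0 (r + j)
  rw [pochM, pochM, pochM, add_comm r j, poch_add]
  rw [add_comm r j] at h h3
  field_simp
  rw [← h]; ring

lemma fin2 (b b' x y : ℂ) (n : ℕ) :
    ∑ qN ∈ antidiagonal n,
      pochM b' qN.1 * (y - x) ^ qN.1 * pochM (b + b' + qN.1) qN.2 * x ^ qN.2 =
    ∑ ij ∈ antidiagonal n, pochM b ij.1 * pochM b' ij.2 * x ^ ij.1 * y ^ ij.2 := by
  have L : ∀ qN ∈ antidiagonal n,
      pochM b' qN.1 * (y - x) ^ qN.1 * pochM (b + b' + qN.1) qN.2 * x ^ qN.2 =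
      ∑ rj ∈ antidiagonal qN.1, pochM b' rj.2 * y ^ rj.2 * x ^ (rj.1 + qN.2) *
        ((-1) ^ rj.1 * pochM (b' + rj.2) rj.1 * pochM (b + b' + rj.2 + rj.1) qN.2) := by
    intro qN _
    rw [show y - x = -x + y by ring, (Commute.all (-x) y).add_pow', Finset.mul_sum,
      Finset.sum_mul, Finset.sum_mul]
    refine Finset.sum_congr rfl fun rj hrj => ?_
    have hq : qN.1 = rj.1 + rj.2 := (mem_antidiagonal.mp hrj).symm
    rw [nsmul_eq_mul, hq]
    have := pochM_choose b' rj.2 rj.1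
    rw [show b + b' + ((rj.1 + rj.2 : ℕ) : ℂ) = b + b' + rj.2 + rj.1 by push_cast; ring,
      neg_pow x]
    linear_combination ((-1) ^ rj.1 * x ^ rj.1 * y ^ rj.2 *
      pochM (b + b' + rj.2 + rj.1) qN.2 * x ^ qN.2) * this
  have R : ∀ ij ∈ antidiagonal n, pochM b ij.1 * pochM b' ij.2 * x ^ ij.1 * y ^ ij.2 =
      ∑ rN ∈ antidiagonal ij.1, pochM b' ij.2 * y ^ ij.2 * x ^ (rN.1 + rN.2) *
        ((-1) ^ rN.1 * pochM (b' + ij.2) rN.1 * pochM (b + b' + ij.2 + rN.1) rN.2) := by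
    intro ij _
    have := vander (b + b' + ij.2) (b' + ij.2) ij.1
    rw [show b + b' + (ij.2 : ℂ) - (b' + ij.2) = b by ring] at this
    rw [← this, Finset.sum_mul, Finset.sum_mul, Finset.sum_mul]
    refine Finset.sum_congr rfl fun rN hrN => ?_
    rw [mem_antidiagonal.mp hrN]; ring
  rw [Finset.sum_congr rfl L, Finset.sum_congr rfl R, Finset.sum_sigma', Finset.sum_sigma']
  refine Finset.sum_bij' (fun s _ => ⟨(s.2.1 + s.1.2, s.2.2), (s.2.1, s.1.2)⟩)
    (fun s _ => ⟨(s.2.1 + s.1.2, s.2.2), (s.2.1, s.1.2)⟩) ?_ ?_ ?_ ?_ ?_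
  · rintro ⟨⟨q, N⟩, ⟨r, j⟩⟩ h; simp at h ⊢; omega
  · rintro ⟨⟨q, N⟩, ⟨r, j⟩⟩ h; simp at h ⊢; omega
  · rintro ⟨⟨q, N⟩, ⟨r, j⟩⟩ h; simp at h ⊢; omega
  · rintro ⟨⟨q, N⟩, ⟨r, j⟩⟩ h; simp at h ⊢; omega
  · rintro ⟨⟨q, N⟩, ⟨r, j⟩⟩ h; simp

lemma tsum_anti {f : ℕ × ℕ → ℂ} (hf : Summable f) :
    ∑' p, f p = ∑' n, ∑ p ∈ antidiagonal n, f p := by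
  have h := HasAntidiagonal.sigmaAntidiagonalEquivProd.summable_iff.mpr hf
  rw [← HasAntidiagonal.sigmaAntidiagonalEquivProd.tsum_eq f]
  refine (Summable.tsum_sigma' (fun n => (hasSum_fintype _).summable) h).trans ?_
  refine tsum_congr fun n => ?_
  rw [tsum_fintype, ← Finset.sum_attach (antidiagonal n)]; rfl

lemma binom_hasSum (α x : ℂ) (hx : ‖x‖ < 1) :
    HasSum (fun k => pochM α k * x ^ k) ((1 - x) ^ (-α)) := by
  have h := (Complex.one_div_one_sub_cpow_hasFPowerSeriesOnBall_zero α).hasSum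
    (y := x) (by simpa [← ofReal_norm, enorm_eq_nnnorm, ← NNReal.coe_lt_one] using hx)
  simp [FormalMultilinearSeries.ofScalars, ← Ring.multichoose_eq, ← pochM_eq] at h
  rw [Complex.cpow_neg]
  exact h

lemma growth (u ρ : ℕ → ℂ) (hu : ∀ n, u (n + 1) = u n * ρ n)
    (hρ : Filter.Tendsto ρ Filter.atTop (nhds 1)) (r : ℝ) (hr : 1 < r) :
    ∃ K : ℝ, 0 ≤ K ∧ ∀ n, ‖u n‖ ≤ K * r ^ n := by
  have h1 : ∀ᶠ n in Filter.atTop, ‖ρ n‖ < r :=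
    hρ.norm.eventually_lt_const (by simpa using hr)
  obtain ⟨N, hN⟩ := Filter.eventually_atTop.mp h1
  have hr0 : 0 < r := by linarith
  have h2 : ∀ n, N ≤ n → ‖u n‖ ≤ ‖u N‖ * r ^ n := by
    intro n hn
    induction n, hn using Nat.le_induction with
    | base => exact le_mul_of_one_le_right (norm_nonneg _) (one_le_pow₀ hr.le)
    | succ n hn ih =>
      rw [hu, norm_mul, pow_succ, ← mul_assoc]
      exact mul_le_mul ih (hN n hn).le (norm_nonneg _) (by positivity)
  refine ⟨∑ i ∈ range (N + 1), ‖u i‖, by positivity, fun n => ?_⟩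
  have h3 : ∀ i, i ≤ N → ‖u i‖ ≤ ∑ i ∈ range (N + 1), ‖u i‖ := fun i hi =>
    Finset.single_le_sum (f := fun i => ‖u i‖) (fun _ _ => norm_nonneg _)
      (Finset.mem_range.mpr (by omega))
  rcases le_total n N with h | h
  · exact (h3 n h).trans (le_mul_of_one_le_right (by positivity) (one_le_pow₀ hr.le))
  · exact (h2 n h).trans (mul_le_mul_of_nonneg_right (h3 N le_rfl) (by positivity))

lemma ratio_tendsto (a b : ℂ) :
    Filter.Tendsto (fun n : ℕ => (a + n) / (b + n)) Filter.atTop (nhds 1) := by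
  have h := tendsto_add_mul_div_add_mul_atTop_nhds (𝕜 := ℂ) a b 1 (d := 1) one_ne_zero
  simpa using h

lemma growthM (a : ℂ) (r : ℝ) (hr : 1 < r) :
    ∃ K : ℝ, 0 ≤ K ∧ ∀ n, ‖pochM a n‖ ≤ K * r ^ n := by
  refine growth _ _ (fun n => ?_) (ratio_tendsto a 1) r hr
  have h0 : (Nat.factorial n : ℂ) ≠ 0 := by exact_mod_cast Nat.factorial_ne_zero n
  have h1 : (1 + n : ℂ) ≠ 0 := by exact_mod_cast (by omega : 1 + n ≠ 0)
  rw [pochM, pochM, poch_succ, Nat.factorial_succ]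
  push_cast
  rw [add_comm (n : ℂ) 1]
  field_simp

lemma growthI (c : ℂ) (hc : ∀ n : ℕ, c ≠ -(n : ℂ)) (r : ℝ) (hr : 1 < r) :
    ∃ K : ℝ, 0 ≤ K ∧ ∀ n, ‖(pochM c n)⁻¹‖ ≤ K * r ^ n := by
  refine growth _ _ (fun n => ?_) (ratio_tendsto 1 c) r hr
  have h0 : (Nat.factorial n : ℂ) ≠ 0 := by exact_mod_cast Nat.factorial_ne_zero n
  have h1 : (1 + n : ℂ) ≠ 0 := by exact_mod_cast (by omega : 1 + n ≠ 0)
  have h2 := poch_ne_zero hc n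
  have h3 : c + n ≠ 0 := fun h => hc n (eq_neg_of_add_eq_zero_left h)
  rw [pochM, pochM, poch_succ, Nat.factorial_succ]
  push_cast
  rw [add_comm (n : ℂ) 1]
  field_simp

lemma pick_r (s t S T : ℝ) (h : s < t) (H : S < T) :
    ∃ r : ℝ, 1 < r ∧ r ^ 3 * s < t ∧ r ^ 3 * S < T := by
  have h1 : Filter.Tendsto (fun r : ℝ => r ^ 3 * s) (nhdsWithin 1 (Set.Ioi 1)) (nhds s) := by
    have : Continuous fun r : ℝ => r ^ 3 * s := by fun_prop
    simpa using (this.tendsto 1).mono_left nhdsWithin_le_nhds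
  have h2 : Filter.Tendsto (fun r : ℝ => r ^ 3 * S) (nhdsWithin 1 (Set.Ioi 1)) (nhds S) := by
    have : Continuous fun r : ℝ => r ^ 3 * S := by fun_prop
    simpa using (this.tendsto 1).mono_left nhdsWithin_le_nhds
  obtain ⟨r, h3, h4, h5⟩ := ((h1.eventually_lt_const h).and ((h2.eventually_lt_const H).and
    self_mem_nhdsWithin)).exists
  exact ⟨r, h5, h3, h4⟩

lemma F1term_eq (a b b' c x y : ℂ) (i j : ℕ) :
    F1term a b b' c x y (i, j) =
      pochM a (i + j) * (pochM c (i + j))⁻¹ * pochM b i * pochM b' j * x ^ i * y ^ j := by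
  have h0 (n : ℕ) : (Nat.factorial n : ℂ) ≠ 0 := by exact_mod_cast Nat.factorial_ne_zero n
  have h1 := h0 i
  have h2 := h0 j
  have h3 := h0 (i + j)
  simp only [F1term, pochM, inv_div]
  field_simp

lemma summF1 (a b b' c : ℂ) (hc : ∀ n : ℕ, c ≠ -(n : ℂ)) (x y : ℂ) (hx : ‖x‖ < 1)
    (hy : ‖y‖ < 1) : Summable (fun ij : ℕ × ℕ => ‖F1term a b b' c x y ij‖) := by
  obtain ⟨r, hr, hrx, hry⟩ := pick_r _ _ _ _ hx hy
  obtain ⟨Ka, ha0, ha⟩ := growthM a r hr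
  obtain ⟨Kb, hb0, hb⟩ := growthM b r hr
  obtain ⟨Kb', hb'0, hb'⟩ := growthM b' r hr
  obtain ⟨Kc, hc0, hc'⟩ := growthI c hc r hr
  have hr0 : 0 < r := by linarith
  have hs := ((summable_geometric_of_lt_one (by positivity) hrx).mul_of_nonneg
    (summable_geometric_of_lt_one (by positivity) hry) (fun _ => by positivity)
    (fun _ => by positivity)).mul_left (Ka * Kc * Kb * Kb')
  refine hs.of_nonneg_of_le (fun _ => norm_nonneg _) ?_
  rintro ⟨i, j⟩
  rw [F1term_eq]
  simp only [norm_mul, norm_pow]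
  calc _ ≤ (Ka * r ^ (i + j)) * (Kc * r ^ (i + j)) * (Kb * r ^ i) * (Kb' * r ^ j) *
        ‖x‖ ^ i * ‖y‖ ^ j := by
        gcongr
        · exact ha _
        · exact hc' _
        · exact hb _
        · exact hb' _
    _ = _ := by ring

/-- General term of the auxiliary triple series. -/
def tripT (a d b' c x y : ℂ) (t : (ℕ × ℕ) × ℕ) : ℂ :=
  poch a (t.1.1 + t.1.2) * pochM (a + (t.1.1 + t.1.2 : ℕ)) t.2 / poch c (t.1.1 + t.1.2) *
    pochM d t.1.1 * pochM b' t.1.2 * (-x) ^ t.1.1 * (y - x) ^ t.1.2 * x ^ t.2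

lemma tripT_eq (a d b' c x y : ℂ) (p q k : ℕ) :
    tripT a d b' c x y ((p, q), k) =
      pochM a (p + q + k) * (pochM c (p + q))⁻¹ * ((k + (p + q)).choose (p + q) : ℂ) *
      pochM d p * pochM b' q * (-x) ^ p * (y - x) ^ q * x ^ k := by
  have h0 (n : ℕ) : (Nat.factorial n : ℂ) ≠ 0 := by exact_mod_cast Nat.factorial_ne_zero n
  have h1 := h0 (p + q)
  have h := pochM_choose a (p + q) k
  rw [Nat.choose_symm_add, add_comm k] at h
  have h2 : poch a (p + q) = pochM a (p + q) * (Nat.factorial (p + q) : ℂ) := poch_eq _ _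
  have h3 : (pochM c (p + q))⁻¹ = (Nat.factorial (p + q) : ℂ) / poch c (p + q) := by
    rw [pochM, inv_div]
  simp only [tripT]
  rw [h2, h3, add_comm k]
  linear_combination (-(Nat.factorial (p + q) : ℂ) / poch c (p + q) *
      pochM d p * pochM b' q * (-x) ^ p * (y - x) ^ q * x ^ k) * h

lemma summT (a d b' c : ℂ) (hc : ∀ n : ℕ, c ≠ -(n : ℂ)) (x y : ℂ) (hx : ‖x‖ < 1 / 4)
    (hy : ‖y - x‖ < 1 / 2) : Summable (tripT a d b' c x y) := by
  obtain ⟨r, hr, hrx, hry⟩ := pick_r _ _ _ _ hx hy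
  obtain ⟨Ka, ha0, ha⟩ := growthM a r hr
  obtain ⟨Kb, hb0, hb⟩ := growthM d r hr
  obtain ⟨Kb', hb'0, hb'⟩ := growthM b' r hr
  obtain ⟨Kc, hc0, hc'⟩ := growthI c hc r hr
  have hr0 : 0 < r := by linarith
  have hrr : r ≤ r ^ 3 := le_self_pow₀ hr.le (by norm_num)
  set R := r ^ 3 * ‖x‖ with hR
  set S := r ^ 3 * ‖y - x‖ with hS
  have hR0 : 0 ≤ R := by positivity
  have hS0 : 0 ≤ S := by positivity
  have h1R : 0 < 1 - R := by linarith
  have hsum (m : ℕ) : HasSum (fun k : ℕ => ((k + m).choose m : ℝ) * R ^ k)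
      (1 / (1 - R) ^ (m + 1)) :=
    hasSum_choose_mul_geometric_of_norm_lt_one m (by rw [Real.norm_of_nonneg hR0]; linarith)
  have hs : Summable (fun t : (ℕ × ℕ) × ℕ =>
      (R ^ t.1.1 * S ^ t.1.2) *
        (((t.2 + (t.1.1 + t.1.2)).choose (t.1.1 + t.1.2) : ℝ) * R ^ t.2)) := by
    refine (summable_prod_of_nonneg (fun _ => by positivity)).mpr ⟨?_, ?_⟩
    · rintro ⟨p, q⟩
      exact (hsum (p + q)).summable.mul_left (R ^ p * S ^ q)
    · have h3 := ((summable_geometric_of_lt_one (r := R / (1 - R)) (by positivity)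
        (by rw [div_lt_one h1R]; linarith)).mul_of_nonneg
        (summable_geometric_of_lt_one (r := S / (1 - R)) (by positivity)
        (by rw [div_lt_one h1R]; linarith)) (fun _ => by positivity)
        (fun _ => by positivity)).mul_left (1 / (1 - R))
      refine h3.congr ?_
      rintro ⟨p, q⟩
      simp only
      rw [tsum_mul_left, (hsum (p + q)).tsum_eq, div_pow, div_pow, pow_succ, pow_add]
      field_simp
  refine Summable.of_norm_bounded (hs.mul_left (Ka * Kc * Kb * Kb')) ?_
  rintro ⟨⟨p, q⟩, k⟩
  rw [tripT_eq]
  simp only [norm_mul, norm_pow, norm_neg, Complex.norm_natCast]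
  calc _ ≤ (Ka * r ^ (p + q + k)) * (Kc * r ^ (p + q)) *
        ((k + (p + q)).choose (p + q) : ℝ) * (Kb * r ^ p) * (Kb' * r ^ q) *
        ‖x‖ ^ p * ‖y - x‖ ^ q * ‖x‖ ^ k := by
        gcongr
        · exact ha _
        · exact hc' _
        · exact hb _
        · exact hb' _
    _ = Ka * Kc * Kb * Kb' * ((R ^ p * S ^ q) *
        (((k + (p + q)).choose (p + q) : ℝ) * (r * ‖x‖) ^ k)) := by
        rw [hR, hS]; ring
    _ ≤ _ := by
        gcongr
        rw [hR]
        gcongr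

/-- Regrouping of triples `((p, q), k)` according to `q` and `p + k`. -/
def regroup : (Σ qN : ℕ × ℕ, antidiagonal qN.2) ≃ (ℕ × ℕ) × ℕ where
  toFun s := ((s.2.1.1, s.1.1), s.2.1.2)
  invFun t := ⟨(t.1.2, t.1.1 + t.2), ⟨(t.1.1, t.2), by simp⟩⟩
  left_inv := by
    rintro ⟨⟨q, N⟩, ⟨⟨p, k⟩, h⟩⟩
    have h' : p + k = N := by simpa using h
    subst h'
    rfl
  right_inv := by rintro ⟨⟨p, q⟩, k⟩; rfl

/-- Term of the partially summed series. -/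
def dblU (a b b' c x y : ℂ) (s : ℕ × ℕ) : ℂ :=
  poch a (s.1 + s.2) / poch c (s.1 + s.2) *
    (pochM b' s.1 * (y - x) ^ s.1 * pochM (b + b' + s.1) s.2 * x ^ s.2)

lemma inner_trip_sum (a b b' c : ℂ) (hc : ∀ n : ℕ, c ≠ -(n : ℂ)) (x y : ℂ) (q N : ℕ) :
    ∑ pk ∈ antidiagonal N, tripT a (c - b - b') b' c x y ((pk.1, q), pk.2) =
      dblU a b b' c x y (q, N) := by
  have h := vander (c + q) (c - b - b') N
  rw [show c + q - (c - b - b') = b + b' + q by ring] at h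
  simp only [dblU]
  rw [← h, Finset.mul_sum, Finset.sum_mul, Finset.mul_sum]
  refine Finset.sum_congr rfl ?_
  rintro ⟨p, k⟩ hpk
  have hN : p + k = N := mem_antidiagonal.mp hpk
  subst hN
  have e : q + (p + k) = p + q + k := by omega
  have h0 : (Nat.factorial k : ℂ) ≠ 0 := by exact_mod_cast Nat.factorial_ne_zero k
  have h1 := poch_ne_zero hc (p + q)
  have h2 := poch_ne_zero hc (p + q + k)
  have h3 : poch (c + (p + q : ℕ)) k ≠ 0 := fun h => h2 (by rw [poch_add, h, mul_zero])
  simp only [tripT]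
  rw [e, poch_add a (p + q) k, poch_add c (p + q) k,
    show c + (q : ℂ) + p = c + (p + q : ℕ) by push_cast; ring, pochM, pochM.eq_1 (c + _), neg_pow x]
  field_simp
  ring

lemma outer_sum (a b b' c : ℂ) (x y : ℂ) (n : ℕ) :
    ∑ s ∈ antidiagonal n, dblU a b b' c x y s =
      ∑ ij ∈ antidiagonal n, F1term a b b' c x y ij := by
  have h := congrArg (fun z => poch a n / poch c n * z) (fin2 b b' x y n)
  simp only [Finset.mul_sum] at h
  convert h using 1
  · refine Finset.sum_congr rfl fun s hs => ?_
    rw [dblU, mem_antidiagonal.mp hs]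
  · refine Finset.sum_congr rfl fun s hs => ?_
    rw [F1term, mem_antidiagonal.mp hs, pochM, pochM]
    field_simp

lemma tsum_k (a d b' c x y : ℂ) (hx : ‖x‖ < 1) (pq : ℕ × ℕ) :
    ∑' k, tripT a d b' c x y (pq, k) =
      (1 - x) ^ (-a) * F1term a d b' c (-x / (1 - x)) ((y - x) / (1 - x)) pq := by
  obtain ⟨p, q⟩ := pq
  have h := binom_hasSum (a + (p + q : ℕ)) x hx
  have hx1 : 1 - x ≠ 0 := by
    intro h0
    have : x = 1 := by linear_combination -h0
    rw [this] at hx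
    simp at hx
  have e : ∀ k, tripT a d b' c x y ((p, q), k) =
      (poch a (p + q) / poch c (p + q) * pochM d p * pochM b' q * (-x) ^ p * (y - x) ^ q) *
      (pochM (a + (p + q : ℕ)) k * x ^ k) := fun k => by simp only [tripT]; ring
  simp only [e]
  rw [tsum_mul_left, h.tsum_eq, neg_add, Complex.cpow_add _ _ hx1, Complex.cpow_neg _ ((p + q : ℕ) : ℂ),
    Complex.cpow_natCast]
  simp only [F1term, pochM, div_pow, pow_add]
  field_simp

/-- Fact 2.3 (Bailey):
`F₁(a,b,b',c;x,y) = (1−x)^(−a) F₁(a, c−b−b', b', c; −x/(1−x), (y−x)/(1−x))`,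
together with the absolute convergence of both double series, for `|x| < 1/4`, `|y| < 1/4`,
and `c` not a nonpositive integer. -/
theorem stmt6 (a b b' c : ℂ) (hc : ∀ n : ℕ, c ≠ -(n : ℂ))
    (x y : ℂ) (hx : ‖x‖ < 1 / 4) (hy : ‖y‖ < 1 / 4) :
    Summable (fun ij : ℕ × ℕ => ‖F1term a b b' c x y ij‖) ∧
    Summable (fun ij : ℕ × ℕ =>
      ‖F1term a (c - b - b') b' c (-x / (1 - x)) ((y - x) / (1 - x)) ij‖) ∧
    ∑' ij : ℕ × ℕ, F1term a b b' c x y ij =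
      (1 - x) ^ (-a) *
        ∑' ij : ℕ × ℕ, F1term a (c - b - b') b' c (-x / (1 - x)) ((y - x) / (1 - x)) ij := by
  have hx1 : 3 / 4 < ‖1 - x‖ := by
    have := norm_sub_norm_le (1 : ℂ) x
    rw [norm_one] at this
    linarith
  have hyx : ‖y - x‖ < 1 / 2 := by
    have := norm_sub_le y x
    linarith
  have S1 := summF1 a b b' c hc x y (by linarith) (by linarith)
  have S2 := summF1 a (c - b - b') b' c hc (-x / (1 - x)) ((y - x) / (1 - x))
    (by rw [norm_div, norm_neg, div_lt_one (by linarith)]; linarith)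
    (by rw [norm_div, div_lt_one (by linarith)]; linarith)
  refine ⟨S1, S2, ?_⟩
  have ST := summT a (c - b - b') b' c hc x y hx hyx
  have SE := regroup.summable_iff.mpr ST
  have fib : ∀ qN : ℕ × ℕ, ∑' z : antidiagonal qN.2,
      (tripT a (c - b - b') b' c x y ∘ regroup) ⟨qN, z⟩ = dblU a b b' c x y qN := by
    rintro ⟨q, N⟩
    rw [← inner_trip_sum a b b' c hc, tsum_fintype, ← Finset.sum_attach (antidiagonal N)]
    rfl
  have SU : Summable (dblU a b b' c x y) :=
    (SE.sigma' (fun n => (hasSum_fintype _).summable)).congr fib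
  calc ∑' ij : ℕ × ℕ, F1term a b b' c x y ij
      = ∑' s, dblU a b b' c x y s := by
        rw [tsum_anti S1.of_norm, tsum_anti SU]
        exact tsum_congr fun n => (outer_sum a b b' c x y n).symm
    _ = ∑' t, tripT a (c - b - b') b' c x y t := by
        rw [← regroup.tsum_eq]
        refine Eq.symm ((Summable.tsum_sigma' (fun n => (hasSum_fintype _).summable) SE).trans ?_)
        exact tsum_congr fib
    _ = _ := by
        rw [ST.tsum_prod, ← tsum_mul_left]
        exact tsum_congr fun pq => tsum_k a _ b' c x y (by linarith) pq
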